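/- arXiv:2310.00211 — 3 statements merged into one kernel-verified Lean document; each statement's English description precedes it below -/
import Mathlib

section
/- Let p ≥ 2 and let f : S^{p−1} → S^{p−1} be a bijective, spherically weakly isotonic map. Then f is an orthogonal transformation; that is, there exists a linear isometry T of ℝ^p such that f(x) = T(x) for all x ∈ S^{p−1}. -/
open scoped RealInnerProductSpace

section SphericallyIsotonic

variable {E : Type*} [NormedAddCommGroup E] [InnerProductSpace ℝ E]

/-- A self-map of the unit sphere is spherically weakly isotonic if it preserves and reflects
comparisons of inner products with a common point. -/
def SphericallyWeaklyIsotonic (f : Metric.sphere (0 : E) 1 → Metric.sphere (0 : E) 1) : Prop :=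
  ∀ x x' x'' : Metric.sphere (0 : E) 1,
    ⟪(x : E), (x' : E)⟫ < ⟪(x : E), (x'' : E)⟫ ↔
      ⟪(f x : E), (f x' : E)⟫ < ⟪(f x : E), (f x'' : E)⟫

lemma inner_self_of_mem_sphere (x : Metric.sphere (0 : E) 1) : ⟪(x : E), (x : E)⟫ = 1 := by
  simp

lemma inner_le_one_of_mem_sphere (x y : Metric.sphere (0 : E) 1) : ⟪(x : E), (y : E)⟫ ≤ 1 := by
  simpa using real_inner_le_norm (x : E) y

lemma neg_one_le_inner_of_mem_sphere (x y : Metric.sphere (0 : E) 1) :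
    -1 ≤ ⟪(x : E), (y : E)⟫ := by
  have h := inner_le_one_of_mem_sphere x (-y)
  simp only [coe_neg_sphere, inner_neg_right] at h
  linarith

lemma eq_of_one_le_inner {x y : Metric.sphere (0 : E) 1} (h : 1 ≤ ⟪(x : E), (y : E)⟫) : x = y :=
  Subtype.ext <| (inner_eq_one_iff_of_norm_eq_one (𝕜 := ℝ) (by simp) (by simp)).1
    (le_antisymm (inner_le_one_of_mem_sphere x y) h)

lemma mem_sphere_of_inner_self {x : E} (h : ⟪x, x⟫ = 1) : x ∈ Metric.sphere (0 : E) 1 := by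
  rw [mem_sphere_zero_iff_norm]
  rw [real_inner_self_eq_norm_sq] at h
  exact (pow_eq_one_iff_of_nonneg (norm_nonneg x) two_ne_zero).1 h

/-- The point at angle `t` on the great circle from `x` towards a unit vector `u` orthogonal
to `x`. -/
noncomputable def greatCircle (x u : E) (t : ℝ) : E := Real.cos t • x + Real.sin t • u

lemma inner_greatCircle {x u : E} (hx : ⟪x, x⟫ = 1) (hu : ⟪u, u⟫ = 1) (hxu : ⟪x, u⟫ = 0)
    (s t : ℝ) : ⟪greatCircle x u s, greatCircle x u t⟫ = Real.cos (t - s) := by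
  have hux : ⟪u, x⟫ = 0 := by rw [real_inner_comm, hxu]
  simp only [greatCircle, inner_add_left, inner_add_right, real_inner_smul_left,
    real_inner_smul_right, hx, hu, hxu, hux, Real.cos_sub]
  ring

lemma greatCircle_add_add (x u : E) (t d : ℝ) :
    greatCircle x u (t + d + d) =
      (2 * Real.cos d) • greatCircle x u (t + d) - greatCircle x u t := by
  have h1 : Real.cos (t + d + d) = 2 * Real.cos d * Real.cos (t + d) - Real.cos t := by
    rw [Real.cos_add (t + d), Real.sin_add, Real.cos_add]
    linear_combination (-Real.cos t) * Real.sin_sq_add_cos_sq d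
  have h2 : Real.sin (t + d + d) = 2 * Real.cos d * Real.sin (t + d) - Real.sin t := by
    rw [Real.sin_add (t + d), Real.sin_add, Real.cos_add]
    linear_combination (-Real.sin t) * Real.sin_sq_add_cos_sq d
  simp only [greatCircle, h1, h2]
  module

lemma exists_nat_mul_pi_div_two_pow_btwn {a b : ℝ} (ha : 0 ≤ a) (hab : a < b) :
    ∃ k n : ℕ, 1 ≤ k ∧ a < n * (Real.pi / 2 ^ k) ∧ n * (Real.pi / 2 ^ k) < b := by
  obtain ⟨k, hk⟩ := pow_unbounded_of_one_lt (Real.pi / (b - a)) (one_lt_two (α := ℝ))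
  have hd : Real.pi / 2 ^ (k + 1) < b - a := by
    have h0 : (0 : ℝ) < b - a := sub_pos.2 hab
    have h2 : (0 : ℝ) < 2 ^ k := by positivity
    rw [div_lt_iff₀ h0] at hk
    rw [div_lt_iff₀ (by positivity), pow_succ]
    nlinarith
  have hpos : 0 < Real.pi / 2 ^ (k + 1) := by positivity
  refine ⟨k + 1, ⌊a / (Real.pi / 2 ^ (k + 1))⌋₊ + 1, by omega, ?_, ?_⟩
  · have := Nat.lt_floor_add_one (a / (Real.pi / 2 ^ (k + 1)))
    rw [div_lt_iff₀ hpos] at this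
    exact_mod_cast this
  · have := Nat.floor_le (div_nonneg ha hpos.le)
    rw [le_div_iff₀ hpos] at this
    push_cast
    linarith

namespace SphericallyWeaklyIsotonic

variable {f : Metric.sphere (0 : E) 1 → Metric.sphere (0 : E) 1}

lemma inner_le_iff (hf : SphericallyWeaklyIsotonic f) (x y z : Metric.sphere (0 : E) 1) :
    ⟪(f x : E), (f y : E)⟫ ≤ ⟪(f x : E), (f z : E)⟫ ↔ ⟪(x : E), (y : E)⟫ ≤ ⟪(x : E), (z : E)⟫ := by
  rw [← not_lt, ← not_lt, hf x z y]

lemma inner_eq_iff (hf : SphericallyWeaklyIsotonic f) (x y z : Metric.sphere (0 : E) 1) :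
    ⟪(f x : E), (f y : E)⟫ = ⟪(f x : E), (f z : E)⟫ ↔ ⟪(x : E), (y : E)⟫ = ⟪(x : E), (z : E)⟫ := by
  simp only [le_antisymm_iff, hf.inner_le_iff]

lemma map_neg (hf : SphericallyWeaklyIsotonic f) (hs : Function.Surjective f)
    (x : Metric.sphere (0 : E) 1) : f (-x) = -f x := by
  obtain ⟨y, hy⟩ := hs (-f x)
  have h : ⟪(f x : E), (f (-x) : E)⟫ ≤ ⟪(f x : E), (f y : E)⟫ := by
    rw [hf.inner_le_iff, coe_neg_sphere, inner_neg_right, inner_self_of_mem_sphere]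
    exact neg_one_le_inner_of_mem_sphere x y
  rw [hy, coe_neg_sphere, inner_neg_right, inner_self_of_mem_sphere] at h
  refine (eq_of_one_le_inner ?_).symm
  rw [coe_neg_sphere, inner_neg_left]
  linarith

lemma inner_map_eq_zero (hf : SphericallyWeaklyIsotonic f) (hs : Function.Surjective f)
    {x y : Metric.sphere (0 : E) 1} (h : ⟪(x : E), (y : E)⟫ = 0) :
    ⟪(f x : E), (f y : E)⟫ = 0 := by
  have h1 : ⟪(f x : E), (f y : E)⟫ = ⟪(f x : E), (f (-y) : E)⟫ := by
    rw [hf.inner_eq_iff, coe_neg_sphere, inner_neg_right, h, neg_zero]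
  rw [hf.map_neg hs, coe_neg_sphere, inner_neg_right] at h1
  linarith

lemma inner_map_pos (hf : SphericallyWeaklyIsotonic f) (hs : Function.Surjective f)
    {x y : Metric.sphere (0 : E) 1} (h : 0 < ⟪(x : E), (y : E)⟫) :
    0 < ⟪(f x : E), (f y : E)⟫ := by
  have h1 : ⟪(f x : E), (f (-y) : E)⟫ < ⟪(f x : E), (f y : E)⟫ := by
    rw [← hf, coe_neg_sphere, inner_neg_right]
    linarith
  rw [hf.map_neg hs, coe_neg_sphere, inner_neg_right] at h1
  linarith

/-- A bijective spherically weakly isotonic map preserves spherical midpoints: if `m` is the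
midpoint of `y` and `z`, then `f m` is the midpoint of `f y` and `f z`. -/
lemma map_eq_of_midpoint (hf : SphericallyWeaklyIsotonic f) (hb : Function.Bijective f)
    {y m z : Metric.sphere (0 : E) 1} (hc : 0 ≤ ⟪(y : E), (m : E)⟫)
    (hz : (z : E) = (2 * ⟪(y : E), (m : E)⟫) • (m : E) - y) :
    (f z : E) = (2 * ⟪(f y : E), (f m : E)⟫) • (f m : E) - f y := by
  rcases hc.eq_or_lt with h0 | hpos
  · have hzy : z = -y := Subtype.ext (by rw [hz, ← h0, coe_neg_sphere]; simp)
    rw [hf.inner_map_eq_zero hb.2 h0.symm, hzy, hf.map_neg hb.2]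
    simp
  have hsum : (f y : E) + f z ≠ 0 := by
    intro h
    have h1 : f z = f (-y) := by
      rw [hf.map_neg hb.2]
      exact Subtype.ext (by rw [coe_neg_sphere]; exact (neg_eq_of_add_eq_zero_right h).symm)
    have h2 := hb.1 h1
    rw [h2, coe_neg_sphere] at hz
    have h3 := congrArg (fun v => ⟪v, (m : E)⟫) hz
    simp only [inner_neg_left, inner_sub_left, real_inner_smul_left,
      inner_self_of_mem_sphere] at h3
    linarith
  set s : ℝ := ‖(f y : E) + f z‖ with hs
  have hspos : 0 < s := norm_pos_iff.2 hsum
  obtain ⟨w, hw⟩ := hb.2 ⟨s⁻¹ • ((f y : E) + f z), by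
    rw [mem_sphere_zero_iff_norm, norm_smul, ← hs, norm_inv, Real.norm_of_nonneg hspos.le,
      inv_mul_cancel₀ hspos.ne']⟩
  have hw' : (f y : E) + f z = s • (f w : E) := by
    rw [hw, smul_smul, mul_inv_cancel₀ hspos.ne', one_smul]
  have hfz : (f z : E) = s • (f w : E) - f y := by rw [← hw']; abel
  have hyy := inner_self_of_mem_sphere (f y)
  have hww := inner_self_of_mem_sphere (f w)
  have hwy : 2 * ⟪(f w : E), (f y : E)⟫ = s := by
    have hzz := inner_self_of_mem_sphere (f z)
    rw [hfz] at hzz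
    simp only [inner_sub_left, inner_sub_right, real_inner_smul_left, real_inner_smul_right,
      hyy, hww, real_inner_comm (f w : E) (f y : E)] at hzz
    have : s * (s - 2 * ⟪(f w : E), (f y : E)⟫) = 0 := by linear_combination hzz
    rcases mul_eq_zero.1 this with h | h <;> linarith
  have hwz : ⟪(f w : E), (f y : E)⟫ = ⟪(f w : E), (f z : E)⟫ := by
    rw [hfz, inner_sub_right, real_inner_smul_right, hww]
    linarith
  rw [hf.inner_eq_iff, hz, inner_sub_right, real_inner_smul_right] at hwz
  have hle : ⟪(f y : E), (f w : E)⟫ ≤ ⟪(f y : E), (f m : E)⟫ := by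
    rw [hf.inner_le_iff, real_inner_comm]
    nlinarith [inner_le_one_of_mem_sphere w m]
  have hmz : ⟪(f m : E), (f y : E)⟫ = ⟪(f m : E), (f z : E)⟫ := by
    rw [hf.inner_eq_iff, hz, inner_sub_right, real_inner_smul_right, inner_self_of_mem_sphere,
      real_inner_comm]
    ring
  rw [hfz, inner_sub_right, real_inner_smul_right] at hmz
  rw [real_inner_comm, real_inner_comm (f m : E)] at hle
  have hmw : f m = f w := eq_of_one_le_inner (by nlinarith)
  rw [hfz, hmw, real_inner_comm, hwy]

lemma inner_map_of_inner_eq_cos_pi_div_two_pow (hf : SphericallyWeaklyIsotonic f)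
    (hb : Function.Bijective f) (k : ℕ) :
    ∀ x y : Metric.sphere (0 : E) 1, ⟪(x : E), (y : E)⟫ = Real.cos (Real.pi / 2 ^ (k + 1)) →
      ⟪(f x : E), (f y : E)⟫ = Real.cos (Real.pi / 2 ^ (k + 1)) := by
  induction k with
  | zero =>
    intro x y h
    simp only [zero_add, pow_one, Real.cos_pi_div_two] at h ⊢
    exact hf.inner_map_eq_zero hb.2 h
  | succ k ih =>
    intro x y h
    have hdouble : Real.cos (Real.pi / 2 ^ (k + 1)) =
        2 * Real.cos (Real.pi / 2 ^ (k + 1 + 1)) ^ 2 - 1 := by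
      rw [← Real.cos_two_mul]
      congr 1
      field_simp
      ring
    have hpos : 0 < Real.cos (Real.pi / 2 ^ (k + 1 + 1)) := by
      apply Real.cos_pos_of_mem_Ioo
      have h2 : (1 : ℝ) < 2 ^ (k + 1) := one_lt_pow₀ one_lt_two (by omega)
      constructor
      · have : 0 < Real.pi / 2 ^ (k + 1 + 1) := by positivity
        linarith [Real.pi_pos]
      · apply div_lt_div_of_pos_left Real.pi_pos two_pos
        rw [pow_succ]
        linarith
    set c := Real.cos (Real.pi / 2 ^ (k + 1 + 1))
    have hxx := inner_self_of_mem_sphere x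
    have hyy := inner_self_of_mem_sphere y
    have hyx : ⟪(y : E), (x : E)⟫ = c := by rw [real_inner_comm, h]
    let z : Metric.sphere (0 : E) 1 := ⟨(2 * ⟪(x : E), (y : E)⟫) • (y : E) - x, by
      apply mem_sphere_of_inner_self
      simp only [inner_sub_left, inner_sub_right, real_inner_smul_left, real_inner_smul_right,
        hxx, hyy, h, hyx]
      ring⟩
    have hxz : ⟪(x : E), (z : E)⟫ = Real.cos (Real.pi / 2 ^ (k + 1)) := by
      simp only [z, inner_sub_right, real_inner_smul_right, hxx, h, hdouble]
      ring
    have hfz := hf.map_eq_of_midpoint hb (y := x) (m := y) (z := z) (by rw [h]; exact hpos.le) rfl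
    have h1 := ih x z hxz
    rw [hfz, inner_sub_right, real_inner_smul_right, inner_self_of_mem_sphere, hdouble] at h1
    have h2 := hf.inner_map_pos hb.2 (x := x) (y := y) (by rw [h]; exact hpos)
    exact (pow_left_inj₀ h2.le hpos.le two_ne_zero).1 (by linarith)

lemma inner_map_greatCircle (hf : SphericallyWeaklyIsotonic f) (hb : Function.Bijective f)
    {x u : E} (hx : ⟪x, x⟫ = 1) (hu : ⟪u, u⟫ = 1) (hxu : ⟪x, u⟫ = 0) (k : ℕ)
    (P : ℕ → Metric.sphere (0 : E) 1)
    (hP : ∀ n : ℕ, (P n : E) = greatCircle x u (n * (Real.pi / 2 ^ (k + 1)))) (n : ℕ) :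
    ⟪(f (P 0) : E), (f (P n) : E)⟫ = Real.cos (n * (Real.pi / 2 ^ (k + 1))) := by
  have hstep (n : ℕ) : ⟪(P n : E), (P (n + 1) : E)⟫ = Real.cos (Real.pi / 2 ^ (k + 1)) := by
    rw [hP, hP, inner_greatCircle hx hu hxu]
    congr 1
    push_cast
    ring
  have hfstep (n : ℕ) := hf.inner_map_of_inner_eq_cos_pi_div_two_pow hb k _ _ (hstep n)
  have hnonneg : 0 ≤ Real.cos (Real.pi / 2 ^ (k + 1)) := by
    apply Real.cos_nonneg_of_mem_Icc
    have h2 : (1 : ℝ) ≤ 2 ^ k := one_le_pow₀ one_le_two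
    constructor
    · have : 0 < Real.pi / 2 ^ (k + 1) := by positivity
      linarith [Real.pi_pos]
    · apply div_le_div_of_nonneg_left Real.pi_pos.le two_pos
      rw [pow_succ]
      linarith
  set d := Real.pi / 2 ^ (k + 1)
  have hrec (n : ℕ) :
      (f (P (n + 2)) : E) = (2 * Real.cos d) • (f (P (n + 1)) : E) - f (P n) := by
    rw [← hfstep n]
    apply hf.map_eq_of_midpoint hb
    · rw [hstep]
      exact hnonneg
    · rw [hstep, hP, hP, hP]
      convert greatCircle_add_add x u (n * d) d using 3 <;> push_cast <;> ring_nf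
  induction n using Nat.twoStepInduction with
  | zero => simp
  | one => simpa using hfstep 0
  | more n ih1 ih2 =>
    rw [hrec, inner_sub_right, real_inner_smul_right, ih1, ih2]
    have h1 : ((n + 1 : ℕ) : ℝ) * d = n * d + d := by push_cast; ring
    have h2 : ((n + 2 : ℕ) : ℝ) * d = n * d + d + d := by push_cast; ring
    rw [h1, h2, Real.cos_add (n * d + d), Real.sin_add, Real.cos_add]
    linear_combination (Real.cos (n * d)) * Real.sin_sq_add_cos_sq d

/-- A bijective spherically weakly isotonic map preserves inner products. -/
theorem inner_map_map (hf : SphericallyWeaklyIsotonic f) (hb : Function.Bijective f)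
    (x y : Metric.sphere (0 : E) 1) : ⟪(f x : E), (f y : E)⟫ = ⟪(x : E), (y : E)⟫ := by
  have hxx := inner_self_of_mem_sphere x
  have hyy := inner_self_of_mem_sphere y
  set c := ⟪(x : E), (y : E)⟫ with hc
  have hyx : ⟪(y : E), (x : E)⟫ = c := by rw [real_inner_comm]
  rcases (inner_le_one_of_mem_sphere x y).eq_or_lt with h1 | h1
  · rw [hc, h1, eq_of_one_le_inner h1.ge, inner_self_of_mem_sphere]
  rcases (neg_one_le_inner_of_mem_sphere x y).eq_or_lt' with h2 | h2
  · have h3 : x = -y := eq_of_one_le_inner (by rw [coe_neg_sphere, inner_neg_right, h2, neg_neg])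
    rw [hc, h2, h3, hf.map_neg hb.2, coe_neg_sphere, inner_neg_left, inner_self_of_mem_sphere]
  rw [← hc] at h1 h2
  have hpos : 0 < 1 - c ^ 2 := by nlinarith
  have hroot := Real.sq_sqrt hpos.le
  have hroot0 := (Real.sqrt_pos.2 hpos).ne'
  set r := √(1 - c ^ 2)
  let u : E := r⁻¹ • ((y : E) - c • (x : E))
  have hu : ⟪u, u⟫ = 1 := by
    simp only [u, inner_sub_left, inner_sub_right, real_inner_smul_left, real_inner_smul_right,
      hxx, hyy, hyx, ← hc]
    field_simp
    linear_combination -hroot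
  have hxu : ⟪(x : E), u⟫ = 0 := by
    simp only [u, inner_sub_right, real_inner_smul_right, hxx, ← hc]
    ring
  have key (k n : ℕ) : ∃ q : Metric.sphere (0 : E) 1,
      ⟪(x : E), (q : E)⟫ = Real.cos (n * (Real.pi / 2 ^ (k + 1))) ∧
      ⟪(f x : E), (f q : E)⟫ = Real.cos (n * (Real.pi / 2 ^ (k + 1))) := by
    let P (n : ℕ) : Metric.sphere (0 : E) 1 :=
      ⟨greatCircle x u (n * (Real.pi / 2 ^ (k + 1))), mem_sphere_of_inner_self (by
        rw [inner_greatCircle hxx hu hxu, sub_self, Real.cos_zero])⟩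
    have hP0 : P 0 = x := Subtype.ext (by simp [P, greatCircle])
    have h := hf.inner_map_greatCircle hb hxx hu hxu k P (fun _ => rfl) n
    rw [hP0] at h
    refine ⟨P n, ?_, h⟩
    have h' := inner_greatCircle hxx hu hxu 0 (n * (Real.pi / 2 ^ (k + 1)))
    simpa [P, greatCircle] using h'
  have hc1 := Real.cos_arccos h2.le h1.le
  have hc2 := Real.cos_arccos (neg_one_le_inner_of_mem_sphere (f x) (f y))
    (inner_le_one_of_mem_sphere (f x) (f y))
  set e := ⟪(f x : E), (f y : E)⟫ with he
  by_contra hne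
  rcases lt_or_gt_of_ne hne with hlt | hlt
  · have hlt' := Real.arccos_lt_arccos (neg_one_le_inner_of_mem_sphere (f x) (f y)) hlt h1.le
    obtain ⟨k, n, hk, hn1, hn2⟩ := exists_nat_mul_pi_div_two_pow_btwn (Real.arccos_nonneg c) hlt'
    obtain ⟨k, rfl⟩ := Nat.exists_eq_add_of_le' hk
    obtain ⟨q, hq1, hq2⟩ := key k n
    have h3 := Real.cos_lt_cos_of_nonneg_of_le_pi (Real.arccos_nonneg c)
      (hn2.le.trans (Real.arccos_le_pi _)) hn1
    have h4 := Real.cos_lt_cos_of_nonneg_of_le_pi ((Real.arccos_nonneg c).trans hn1.le)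
      (Real.arccos_le_pi _) hn2
    rw [hc1, ← hq1, hc, hf, hq2] at h3
    rw [hc2] at h4
    exact lt_asymm h3 h4
  · have hlt' := Real.arccos_lt_arccos h2.le hlt (inner_le_one_of_mem_sphere (f x) (f y))
    obtain ⟨k, n, hk, hn1, hn2⟩ := exists_nat_mul_pi_div_two_pow_btwn (Real.arccos_nonneg _) hlt'
    obtain ⟨k, rfl⟩ := Nat.exists_eq_add_of_le' hk
    obtain ⟨q, hq1, hq2⟩ := key k n
    have h3 := Real.cos_lt_cos_of_nonneg_of_le_pi (Real.arccos_nonneg _)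
      (hn2.le.trans (Real.arccos_le_pi _)) hn1
    have h4 := Real.cos_lt_cos_of_nonneg_of_le_pi ((Real.arccos_nonneg _).trans hn1.le)
      (Real.arccos_le_pi _) hn2
    rw [hc1, ← hq1, hc, hf, hq2] at h4
    rw [hc2] at h3
    exact lt_asymm h3 h4

end SphericallyWeaklyIsotonic

/-- An inner-product-preserving self-map of the unit sphere of a finite-dimensional space extends
to a linear isometry. -/
theorem exists_linearIsometryEquiv_of_inner_map_map [FiniteDimensional ℝ E]
    {f : Metric.sphere (0 : E) 1 → Metric.sphere (0 : E) 1}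
    (hf : ∀ x y, ⟪(f x : E), (f y : E)⟫ = ⟪(x : E), (y : E)⟫) :
    ∃ T : E ≃ₗᵢ[ℝ] E, ∀ x, (f x : E) = T x := by
  let b := stdOrthonormalBasis ℝ E
  let v (i : Fin (Module.finrank ℝ E)) : Metric.sphere (0 : E) 1 := ⟨b i, by simp⟩
  have hv : Orthonormal ℝ fun i => (f (v i) : E) := by
    rw [orthonormal_iff_ite]
    intro i j
    rw [hf]
    exact orthonormal_iff_ite.1 b.orthonormal i j
  let b' : OrthonormalBasis (Fin (Module.finrank ℝ E)) ℝ E :=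
    OrthonormalBasis.mk hv (hv.linearIndependent.span_eq_top_of_card_eq_finrank' (by simp)).ge
  have hb' (i) : b' i = f (v i) := by simp [b']
  let T := b.equiv b' (Equiv.refl _)
  have hT (i) : T (b i) = f (v i) := by simp [T, hb']
  refine ⟨T, fun x => InnerProductSpace.ext_inner_left_basis b'.toBasis fun i => ?_⟩
  rw [OrthonormalBasis.coe_toBasis, hb', hf, ← hT, T.inner_map_map]

end SphericallyIsotonic



/-- **Proposition: spherical ordinal MDS.** Let `p ≥ 2` and let
`f : S^{p−1} → S^{p−1}` be bijective and spherically weakly isotonic. Then `f`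
is an orthogonal transformation: there is a linear isometry `T` of `ℝ^p` with
`f x = T x` for all `x ∈ S^{p−1}`. -/
theorem spherical_mds_orthogonal
    (p : ℕ) (hp : 2 ≤ p)
    (f : Metric.sphere (0 : EuclideanSpace ℝ (Fin p)) 1 →
         Metric.sphere (0 : EuclideanSpace ℝ (Fin p)) 1)
    (hbij : Function.Bijective f)
    (hiso : ∀ x x' x'' : Metric.sphere (0 : EuclideanSpace ℝ (Fin p)) 1,
      (⟪(x : EuclideanSpace ℝ (Fin p)), (x' : EuclideanSpace ℝ (Fin p))⟫ <
        ⟪(x : EuclideanSpace ℝ (Fin p)), (x'' : EuclideanSpace ℝ (Fin p))⟫ ↔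
       ⟪(f x : EuclideanSpace ℝ (Fin p)), (f x' : EuclideanSpace ℝ (Fin p))⟫ <
        ⟪(f x : EuclideanSpace ℝ (Fin p)), (f x'' : EuclideanSpace ℝ (Fin p))⟫)) :
    ∃ T : EuclideanSpace ℝ (Fin p) ≃ₗᵢ[ℝ] EuclideanSpace ℝ (Fin p),
      ∀ x : Metric.sphere (0 : EuclideanSpace ℝ (Fin p)) 1,
        (f x : EuclideanSpace ℝ (Fin p)) = T x := by
  exact exists_linearIsometryEquiv_of_inner_map_map
    (SphericallyWeaklyIsotonic.inner_map_map (f := f) hiso hbij)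
end

section
/- Let p ≥ 2 and let f : S^{p−1} → S^{p−1} be a bijective, spherically weakly isotonic map. Then f is continuous. -/
open scoped RealInnerProductSpace

/-- On the unit sphere, a larger inner product means a smaller distance. -/
theorem inner_lt_inner_iff_dist_lt_dist_of_mem_unit_sphere {E : Type*} [NormedAddCommGroup E]
    [InnerProductSpace ℝ E] (a b c : Metric.sphere (0 : E) 1) :
    ⟪(a : E), (b : E)⟫ < ⟪(a : E), (c : E)⟫ ↔ dist a c < dist a b := by
  have norm_sq (d : Metric.sphere (0 : E) 1) : dist a d ^ 2 = 2 - 2 * ⟪(a : E), (d : E)⟫ := by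
    rw [Subtype.dist_eq, dist_eq_norm, norm_sub_sq_real, norm_eq_of_mem_sphere,
      norm_eq_of_mem_sphere]
    ring
  rw [← pow_lt_pow_iff_left₀ dist_nonneg dist_nonneg two_ne_zero, norm_sq, norm_sq]
  constructor <;> intro h <;> linarith

/-- The unit sphere of a real normed space of dimension at least two has no isolated points. -/
theorem exists_ne_dist_lt_unit_sphere {E : Type*} [NormedAddCommGroup E] [NormedSpace ℝ E]
    (hE : 1 < Module.rank ℝ E) (a : Metric.sphere (0 : E) 1) {ε : ℝ} (hε : 0 < ε) :
    ∃ b : Metric.sphere (0 : E) 1, b ≠ a ∧ dist a b < ε := by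
  have : ConnectedSpace (Metric.sphere (0 : E) 1) :=
    isConnected_iff_connectedSpace.mp (isConnected_sphere hE 0 zero_le_one)
  have : Nontrivial (Metric.sphere (0 : E) 1) :=
    ⟨⟨a, -a, ne_neg_of_mem_unit_sphere ℝ a⟩⟩
  have : (nhdsWithin a {a}ᶜ).NeBot :=
    ConnectedSpace.neBot_nhdsWithin_compl_of_nontrivial_of_t1space a
  obtain ⟨b, hb, hne⟩ := Filter.nonempty_of_mem
    (inter_mem_nhdsWithin {a}ᶜ (Metric.ball_mem_nhds a hε))
  exact ⟨b, hb, by rwa [dist_comm]⟩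

/-- **Lemma: continuity.** Let `p ≥ 2` and let
`f : S^{p−1} → S^{p−1}` be bijective and spherically weakly isotonic. Then `f`
is continuous (for the metric induced from `ℝ^p`). -/
theorem spherical_mds_continuous
    (p : ℕ) (hp : 2 ≤ p)
    (f : Metric.sphere (0 : EuclideanSpace ℝ (Fin p)) 1 →
         Metric.sphere (0 : EuclideanSpace ℝ (Fin p)) 1)
    (hbij : Function.Bijective f)
    (hiso : ∀ x x' x'' : Metric.sphere (0 : EuclideanSpace ℝ (Fin p)) 1,
      (⟪(x : EuclideanSpace ℝ (Fin p)), (x' : EuclideanSpace ℝ (Fin p))⟫ <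
        ⟪(x : EuclideanSpace ℝ (Fin p)), (x'' : EuclideanSpace ℝ (Fin p))⟫ ↔
       ⟪(f x : EuclideanSpace ℝ (Fin p)), (f x' : EuclideanSpace ℝ (Fin p))⟫ <
        ⟪(f x : EuclideanSpace ℝ (Fin p)), (f x'' : EuclideanSpace ℝ (Fin p))⟫)) :
    Continuous f := by
  simp only [inner_lt_inner_iff_dist_lt_dist_of_mem_unit_sphere] at hiso
  have hrank : 1 < Module.rank ℝ (EuclideanSpace ℝ (Fin p)) := by
    rw [← Module.finrank_eq_rank, finrank_euclideanSpace_fin]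
    exact_mod_cast hp
  refine Metric.continuous_iff.mpr fun x ε hε => ?_
  obtain ⟨z, hzx, hz⟩ := exists_ne_dist_lt_unit_sphere hrank (f x) hε
  obtain ⟨w, rfl⟩ := hbij.surjective z
  have hwx : x ≠ w := by
    rintro rfl
    exact hzx rfl
  refine ⟨dist x w, dist_pos.mpr hwx, fun y hy => ?_⟩
  rw [dist_comm] at hy ⊢
  exact ((hiso x w y).mp hy).trans hz
end

section
/- Let p ≥ 2 and let f : S^{p−1} → S^{p−1} be a bijective, spherically weakly isotonic map. Then f preserves spherical midpoints: for all x, x' ∈ S^{p−1} with x ≠ x' and x ≠ −x', one has f(x) ≠ −f(x') and f((x + x')/‖x + x'‖) = (f(x) + f(x'))/‖f(x) + f(x')‖. -/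
open scoped RealInnerProductSpace

/-- A unit vector `y` attaining the Cauchy-Schwarz bound against `s ≠ 0` is the normalization
of `s`. -/
theorem eq_inv_norm_smul_of_norm_le_inner {E : Type*} [NormedAddCommGroup E]
    [InnerProductSpace ℝ E] {s y : E} (hs : s ≠ 0) (hy : ‖y‖ = 1) (h : ‖s‖ ≤ ⟪s, y⟫) :
    y = ‖s‖⁻¹ • s := by
  have hle : ⟪s, y⟫ ≤ ‖s‖ * ‖y‖ := real_inner_le_norm s y
  have heq : ⟪s, y⟫ = ‖s‖ * ‖y‖ := le_antisymm hle (by rwa [hy, mul_one])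
  rw [inner_eq_norm_mul_iff_real, hy, one_smul] at heq
  exact (eq_inv_smul_iff₀ (norm_ne_zero_iff.mpr hs)).mpr heq.symm

theorem inner_add_inv_norm_smul_add {E : Type*} [NormedAddCommGroup E]
    [InnerProductSpace ℝ E] (a b : E) : ⟪a + b, ‖a + b‖⁻¹ • (a + b)⟫ = ‖a + b‖ := by
  rw [real_inner_smul_right, real_inner_self_eq_norm_mul_norm]
  rcases eq_or_ne ‖a + b‖ 0 with h | h
  · simp [h]
  · field_simp

/-- The normalized sum of two unit vectors is equidistant from them. -/
theorem inner_inv_norm_smul_add_left_eq_right {E : Type*} [NormedAddCommGroup E]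
    [InnerProductSpace ℝ E] {a b : E} (ha : ‖a‖ = 1) (hb : ‖b‖ = 1) :
    ⟪‖a + b‖⁻¹ • (a + b), a⟫ = ⟪‖a + b‖⁻¹ • (a + b), b⟫ := by
  simp only [real_inner_smul_left, inner_add_left, real_inner_self_eq_norm_sq, ha, hb,
    real_inner_comm b a]
  ring

/-- **Lemma: `f` preserves spherical midpoints.** Let `p ≥ 2`
and let `f : S^{p−1} → S^{p−1}` be bijective and spherically weakly isotonic.
For all `x ≠ x'` on the sphere with `x ≠ −x'`, one has `f x ≠ −f x'`, and `f`
sends the spherical midpoint `(x + x')/‖x + x'‖` of `x, x'` to the spherical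
midpoint `(f x + f x')/‖f x + f x'‖` of `f x, f x'`. -/
theorem spherical_mds_midpoints
    (p : ℕ) (hp : 2 ≤ p)
    (f : Metric.sphere (0 : EuclideanSpace ℝ (Fin p)) 1 →
         Metric.sphere (0 : EuclideanSpace ℝ (Fin p)) 1)
    (hbij : Function.Bijective f)
    (hiso : ∀ x x' x'' : Metric.sphere (0 : EuclideanSpace ℝ (Fin p)) 1,
      (⟪(x : EuclideanSpace ℝ (Fin p)), (x' : EuclideanSpace ℝ (Fin p))⟫ <
        ⟪(x : EuclideanSpace ℝ (Fin p)), (x'' : EuclideanSpace ℝ (Fin p))⟫ ↔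
       ⟪(f x : EuclideanSpace ℝ (Fin p)), (f x' : EuclideanSpace ℝ (Fin p))⟫ <
        ⟪(f x : EuclideanSpace ℝ (Fin p)), (f x'' : EuclideanSpace ℝ (Fin p))⟫))
    (x x' : Metric.sphere (0 : EuclideanSpace ℝ (Fin p)) 1)
    (hne : x ≠ x')
    (hnanti : (x : EuclideanSpace ℝ (Fin p)) ≠ -(x' : EuclideanSpace ℝ (Fin p))) :
    (f x : EuclideanSpace ℝ (Fin p)) ≠ -(f x' : EuclideanSpace ℝ (Fin p)) ∧
    ∀ m : Metric.sphere (0 : EuclideanSpace ℝ (Fin p)) 1,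
      (m : EuclideanSpace ℝ (Fin p)) =
        ‖(x : EuclideanSpace ℝ (Fin p)) + (x' : EuclideanSpace ℝ (Fin p))‖⁻¹ •
          ((x : EuclideanSpace ℝ (Fin p)) + (x' : EuclideanSpace ℝ (Fin p))) →
      (f m : EuclideanSpace ℝ (Fin p)) =
        ‖(f x : EuclideanSpace ℝ (Fin p)) + (f x' : EuclideanSpace ℝ (Fin p))‖⁻¹ •
          ((f x : EuclideanSpace ℝ (Fin p)) + (f x' : EuclideanSpace ℝ (Fin p))) := by
  have hsurj := hbij.surjective
  have hle (u v w : Metric.sphere (0 : EuclideanSpace ℝ (Fin p)) 1) :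
      ⟪(u : EuclideanSpace ℝ (Fin p)), (v : EuclideanSpace ℝ (Fin p))⟫ ≤
        ⟪(u : EuclideanSpace ℝ (Fin p)), (w : EuclideanSpace ℝ (Fin p))⟫ ↔
      ⟪(f u : EuclideanSpace ℝ (Fin p)), (f v : EuclideanSpace ℝ (Fin p))⟫ ≤
        ⟪(f u : EuclideanSpace ℝ (Fin p)), (f w : EuclideanSpace ℝ (Fin p))⟫ := by
    rw [← not_lt, hiso, not_lt]
  have heq (u v w : Metric.sphere (0 : EuclideanSpace ℝ (Fin p)) 1) :
      ⟪(u : EuclideanSpace ℝ (Fin p)), (v : EuclideanSpace ℝ (Fin p))⟫ =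
        ⟪(u : EuclideanSpace ℝ (Fin p)), (w : EuclideanSpace ℝ (Fin p))⟫ ↔
      ⟪(f u : EuclideanSpace ℝ (Fin p)), (f v : EuclideanSpace ℝ (Fin p))⟫ =
        ⟪(f u : EuclideanSpace ℝ (Fin p)), (f w : EuclideanSpace ℝ (Fin p))⟫ := by
    rw [le_antisymm_iff, hle, hle u w v, ← le_antisymm_iff]
  have hnorm (u : Metric.sphere (0 : EuclideanSpace ℝ (Fin p)) 1) :
      ‖(u : EuclideanSpace ℝ (Fin p))‖ = 1 := norm_eq_of_mem_sphere u
  have hanti : (f x : EuclideanSpace ℝ (Fin p)) ≠ -(f x' : EuclideanSpace ℝ (Fin p)) := by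
    intro h
    have hmin := (hle x x' (-x)).mpr (by
      have hlow := neg_one_le_real_inner_of_norm_eq_one (hnorm (f x)) (hnorm (f (-x)))
      have hval : ⟪(f x : EuclideanSpace ℝ (Fin p)), (f x' : EuclideanSpace ℝ (Fin p))⟫ = -1 := by
        rw [h, inner_neg_left, real_inner_self_eq_norm_sq, hnorm, one_pow]
      rwa [hval])
    have hx' : (-(x' : EuclideanSpace ℝ (Fin p))) = x := by
      have hx0 : (x : EuclideanSpace ℝ (Fin p)) ≠ 0 := norm_ne_zero_iff.mp (by simp [hnorm])
      have := eq_inv_norm_smul_of_norm_le_inner hx0 (y := -(x' : EuclideanSpace ℝ (Fin p)))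
        (by rw [norm_neg, hnorm]) (by
          rw [coe_neg_sphere, inner_neg_right, real_inner_self_eq_norm_sq, hnorm] at hmin
          rw [inner_neg_right, hnorm]
          linarith)
      rwa [hnorm, inv_one, one_smul] at this
    exact hnanti hx'.symm
  refine ⟨hanti, fun m hm => ?_⟩
  have hsum : (f x : EuclideanSpace ℝ (Fin p)) + (f x' : EuclideanSpace ℝ (Fin p)) ≠ 0 :=
    fun h => hanti (eq_neg_of_add_eq_zero_left h)
  obtain ⟨z, hz⟩ := hsurj ⟨‖(f x : EuclideanSpace ℝ (Fin p)) + f x'‖⁻¹ •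
      ((f x : EuclideanSpace ℝ (Fin p)) + f x'), by
    rw [mem_sphere_zero_iff_norm, norm_smul, norm_inv, norm_norm,
      inv_mul_cancel₀ (norm_ne_zero_iff.mpr hsum)]⟩
  replace hz := congrArg Subtype.val hz
  dsimp only at hz
  have hmeq : ⟪(m : EuclideanSpace ℝ (Fin p)), (x : EuclideanSpace ℝ (Fin p))⟫ =
      ⟪(m : EuclideanSpace ℝ (Fin p)), (x' : EuclideanSpace ℝ (Fin p))⟫ := by
    rw [hm]
    exact inner_inv_norm_smul_add_left_eq_right (hnorm x) (hnorm x')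
  have hfzeq : ⟪(f z : EuclideanSpace ℝ (Fin p)), (f x : EuclideanSpace ℝ (Fin p))⟫ =
      ⟪(f z : EuclideanSpace ℝ (Fin p)), (f x' : EuclideanSpace ℝ (Fin p))⟫ := by
    rw [hz]
    exact inner_inv_norm_smul_add_left_eq_right (hnorm (f x)) (hnorm (f x'))
  have hzeq := (heq z x x').mpr hfzeq
  have hfmeq := (heq m x x').mp hmeq
  have hmval := inner_add_inv_norm_smul_add (x : EuclideanSpace ℝ (Fin p)) x'
  have hfzval := inner_add_inv_norm_smul_add (f x : EuclideanSpace ℝ (Fin p)) (f x')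
  have hzle := real_inner_le_norm ((x : EuclideanSpace ℝ (Fin p)) + x') z
  rw [hnorm, mul_one] at hzle
  rw [← hm] at hmval
  rw [← hz] at hfzval
  simp only [real_inner_comm _ (m : EuclideanSpace ℝ (Fin p)),
    real_inner_comm _ (z : EuclideanSpace ℝ (Fin p)),
    real_inner_comm _ (f m : EuclideanSpace ℝ (Fin p)),
    real_inner_comm _ (f z : EuclideanSpace ℝ (Fin p))] at hmeq hfzeq hzeq hfmeq
  rw [inner_add_left] at hmval hfzval hzle
  have hmax := (hle x z m).mp (by linarith)
  refine eq_inv_norm_smul_of_norm_le_inner hsum (hnorm _) ?_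
  rw [inner_add_left]
  linarith
end
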